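/- arXiv:1510.01204 — 6 statements merged into one kernel-verified Lean document; each statement's English description precedes it below -/
import Mathlib

section
/- Let γ > 0, δ > 0, α > γ, β > δ, and let f : ℝ → ℝ be integrable with ∫_{-∞}^{∞} f(x) dx = k. Then the function x ↦ ∫_{0}^{1} t^{α-1} (1-t)^{β-1} f(t^γ (1-t)^δ x) dt is integrable on ℝ and ∫_{-∞}^{∞} (∫_{0}^{1} t^{α-1} (1-t)^{β-1} f(t^γ (1-t)^δ x) dt) dx = k · B(α - γ, β - δ), where B(a,b) = Γ(a)Γ(b)/Γ(a+b) is the Euler Beta function. -/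
open MeasureTheory Real

/-- The `(β, δ)`-Borel–Leroy transform:
`(B_{γ,δ}^{(α,β)} f)(x) = ∫_0^1 t^{α-1} (1-t)^{β-1} f(t^γ (1-t)^δ x) dt`. -/
noncomputable def borelLeroy (α β γ δ : ℝ) (f : ℝ → ℝ) (x : ℝ) : ℝ :=
  ∫ t in (0:ℝ)..1, t ^ (α - 1) * (1 - t) ^ (β - 1) * f (t ^ γ * (1 - t) ^ δ * x)

/-- Scaling by an almost everywhere nonzero measurable function is quasi-measure-preserving. -/
lemma quasiMeasurePreserving_mul_of_ae_ne_zero {Ω : Type*} [MeasurableSpace Ω] {μ : Measure Ω}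
    [SFinite μ] {c : Ω → ℝ} (hc : Measurable c) (hc0 : ∀ᵐ t ∂μ, c t ≠ 0) :
    Measure.QuasiMeasurePreserving (fun p : Ω × ℝ => c p.1 * p.2) (μ.prod volume) volume := by
  have hm : Measurable fun p : Ω × ℝ => c p.1 * p.2 := by fun_prop
  refine ⟨hm, Measure.AbsolutelyContinuous.mk fun s hs h0 => ?_⟩
  rw [Measure.map_apply hm hs, Measure.measure_prod_null (hm hs)]
  filter_upwards [hc0] with t ht
  change volume ((fun x => c t * x) ⁻¹' s) = 0
  rw [Real.volume_preimage_mul_left ht, h0, mul_zero]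

/-- A weighted family of dilations of an integrable function is integrable on the product as soon
as the weight divided by the dilation factor is integrable. -/
lemma integrable_prod_mul_comp_mul {Ω : Type*} [MeasurableSpace Ω] {μ : Measure Ω}
    [SFinite μ] {w c : Ω → ℝ} {f : ℝ → ℝ} (hw : Measurable w) (hc : Measurable c)
    (hc0 : ∀ᵐ t ∂μ, c t ≠ 0) (hwc : Integrable (fun t => w t * |(c t)⁻¹|) μ)
    (hf : Integrable f) :
    Integrable (fun p : Ω × ℝ => w p.1 * f (c p.1 * p.2)) (μ.prod volume) := by
  have hmeas : AEStronglyMeasurable (fun p : Ω × ℝ => w p.1 * f (c p.1 * p.2))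
      (μ.prod volume) :=
    (hw.comp measurable_fst).aestronglyMeasurable.mul
      (hf.aestronglyMeasurable.comp_quasiMeasurePreserving
        (quasiMeasurePreserving_mul_of_ae_ne_zero hc hc0))
  rw [integrable_prod_iff hmeas]
  constructor
  · filter_upwards [hc0] with t ht
    exact (hf.comp_mul_left' ht).const_mul _
  · refine (hwc.norm.mul_const (∫ x, ‖f x‖)).congr (Filter.Eventually.of_forall fun t => ?_)
    simp only [norm_mul]
    rw [integral_const_mul, Measure.integral_comp_mul_left (fun x => ‖f x‖)]
    simp [mul_assoc]

/-- On the unit interval, the complex Beta integrand is the cast of the real one. -/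
lemma ofReal_rpow_mul_one_sub_rpow {a b t : ℝ} (ht : t ∈ Set.Ioo (0 : ℝ) 1) :
    (t : ℂ) ^ ((a : ℂ) - 1) * (1 - (t : ℂ)) ^ ((b : ℂ) - 1) =
      ((t ^ (a - 1) * (1 - t) ^ (b - 1) : ℝ) : ℂ) := by
  push_cast [Complex.ofReal_cpow ht.1.le, Complex.ofReal_cpow (sub_nonneg.2 ht.2.le)]
  rfl

lemma integrableOn_rpow_mul_one_sub_rpow {a b : ℝ} (ha : 0 < a) (hb : 0 < b) :
    IntegrableOn (fun t : ℝ => t ^ (a - 1) * (1 - t) ^ (b - 1)) (Set.Ioo 0 1) := by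
  have h := Complex.betaIntegral_convergent (u := a) (v := b) (by simpa) (by simpa)
  rw [intervalIntegrable_iff_integrableOn_Ioo_of_le zero_le_one] at h
  have h' := (integrableOn_congr_fun
    (fun t ht => ofReal_rpow_mul_one_sub_rpow ht) measurableSet_Ioo).1 h
  simpa [IntegrableOn] using h'.re

lemma integral_Ioo_rpow_mul_one_sub_rpow {a b : ℝ} (ha : 0 < a) (hb : 0 < b) :
    ∫ t in Set.Ioo (0 : ℝ) 1, t ^ (a - 1) * (1 - t) ^ (b - 1) =
      Gamma a * Gamma b / Gamma (a + b) := by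
  have h := ProbabilityTheory.beta_eq_betaIntegralReal a b ha hb
  rw [Complex.betaIntegral, intervalIntegral.integral_of_le zero_le_one,
    integral_Ioc_eq_integral_Ioo, setIntegral_congr_fun measurableSet_Ioo
      (fun t ht => ofReal_rpow_mul_one_sub_rpow ht), integral_complex_ofReal,
    Complex.ofReal_re] at h
  exact h.symm

theorem borelLeroy_integral (α β γ δ : ℝ) (hγ : 0 < γ) (hδ : 0 < δ)
    (hαγ : γ < α) (hβδ : δ < β)
    (f : ℝ → ℝ) (k : ℝ) (hf : Integrable f) (hk : ∫ x, f x = k) :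
    Integrable (borelLeroy α β γ δ f) ∧
      ∫ x, borelLeroy α β γ δ f x =
        k * (Real.Gamma (α - γ) * Real.Gamma (β - δ) / Real.Gamma (α - γ + (β - δ))) := by
  set μ : Measure ℝ := volume.restrict (Set.Ioo 0 1)
  set w : ℝ → ℝ := fun t => t ^ (α - 1) * (1 - t) ^ (β - 1)
  set c : ℝ → ℝ := fun t => t ^ γ * (1 - t) ^ δ
  have hw : Measurable w := by fun_prop
  have hc : Measurable c := by fun_prop
  have hpos : ∀ t ∈ Set.Ioo (0 : ℝ) 1, 0 < c t := fun t ht =>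
    mul_pos (rpow_pos_of_pos ht.1 _) (rpow_pos_of_pos (sub_pos.2 ht.2) _)
  have hc0 : ∀ᵐ t ∂μ, c t ≠ 0 :=
    (ae_restrict_mem measurableSet_Ioo).mono fun t ht => (hpos t ht).ne'
  have hquot : Set.EqOn (fun t => t ^ (α - γ - 1) * (1 - t) ^ (β - δ - 1))
      (fun t => w t * |(c t)⁻¹|) (Set.Ioo 0 1) := by
    intro t ht
    have h1 : 0 < 1 - t := sub_pos.2 ht.2
    simp only [abs_of_pos (inv_pos.2 (hpos t ht)), w, c]
    rw [sub_right_comm α, sub_right_comm β, rpow_sub ht.1 (α - 1), rpow_sub h1 (β - 1)]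
    field_simp
  have hα : 0 < α - γ := sub_pos.2 hαγ
  have hβ : 0 < β - δ := sub_pos.2 hβδ
  have hwc : Integrable (fun t => w t * |(c t)⁻¹|) μ :=
    (integrableOn_congr_fun hquot measurableSet_Ioo).1 (integrableOn_rpow_mul_one_sub_rpow hα hβ)
  have hint := integrable_prod_mul_comp_mul hw hc hc0 hwc hf
  have htransform : borelLeroy α β γ δ f = fun x => ∫ t, w t * f (c t * x) ∂μ := by
    ext x
    rw [borelLeroy, intervalIntegral.integral_of_le zero_le_one, integral_Ioc_eq_integral_Ioo]
  rw [htransform]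
  refine ⟨hint.integral_prod_right, ?_⟩
  rw [← integral_integral_swap (f := fun t x => w t * f (c t * x)) hint]
  simp_rw [integral_const_mul, Measure.integral_comp_mul_left, hk, smul_eq_mul, ← mul_assoc]
  rw [integral_mul_const, ← setIntegral_congr_fun measurableSet_Ioo hquot,
    integral_Ioo_rpow_mul_one_sub_rpow hα hβ, mul_comm]
end

section
/- The improper integral of J₀ over the positive half-line equals 1, i.e. the function T ↦ ∫_{0}^{T} J₀(x) dx tends to 1 as T → ∞. -/
/-- The Bessel function of the first kind of order `n`:
`J_n(x) = ∑_{r=0}^∞ (-1)^r / (r! (n+r)!) (x/2)^{n+2r}`. -/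
noncomputable def besselJ (n : ℕ) (x : ℝ) : ℝ :=
  ∑' r : ℕ, (-1 : ℝ) ^ r / (r.factorial * (n + r).factorial) * (x / 2) ^ (n + 2 * r)

open Filter MeasureTheory Set Topology

/-- The **Riemann–Lebesgue lemma** for the sine transform of a function integrable on a set. -/
theorem tendsto_setIntegral_sin_mul_atTop {s : Set ℝ} (hs : MeasurableSet s) {f : ℝ → ℝ}
    (hf : IntegrableOn f s) :
    Tendsto (fun T : ℝ => ∫ x in s, Real.sin (T * x) * f x) atTop (𝓝 0) := by
  have hlim : Tendsto (fun T : ℝ => -T / (2 * Real.pi)) atTop (cocompact ℝ) :=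
    (tendsto_neg_atTop_atBot.atBot_div_const Real.two_pi_pos).mono_right atBot_le_cocompact
  have hRL := (Real.tendsto_integral_exp_smul_cocompact
    (s.indicator fun x => (f x : ℂ))).comp hlim
  have him := (Complex.continuous_im.tendsto _).comp hRL
  rw [Complex.zero_im] at him
  refine him.congr fun T => ?_
  have hexp : ∀ x : ℝ, ((Real.fourierChar (-(x * (-T / (2 * Real.pi)))) : Circle) : ℂ)
      = Complex.exp (((T * x : ℝ) : ℂ) * Complex.I) := by
    intro x
    rw [Real.fourierChar_apply]
    congr 3
    field_simp
  have hint : IntegrableOn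
      (fun x : ℝ => Complex.exp (((T * x : ℝ) : ℂ) * Complex.I) * (f x : ℂ)) s :=
    Integrable.bdd_mul (c := 1) hf.ofReal
      (Continuous.aestronglyMeasurable (by fun_prop))
      (Eventually.of_forall fun x => (Complex.norm_exp_ofReal_mul_I _).le)
  have hind : ∀ x : ℝ, Complex.exp (((T * x : ℝ) : ℂ) * Complex.I)
      * s.indicator (fun x => (f x : ℂ)) x
      = s.indicator (fun x : ℝ => Complex.exp (((T * x : ℝ) : ℂ) * Complex.I) * (f x : ℂ)) x :=
    fun x => (s.indicator_mul_right
      (fun x : ℝ => Complex.exp (((T * x : ℝ) : ℂ) * Complex.I)) fun x => (f x : ℂ)).symm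
  simp only [Function.comp_apply, Circle.smul_def, smul_eq_mul, hexp, hind]
  rw [integral_indicator hs]
  refine (integral_im hint).symm.trans (integral_congr_ae (Eventually.of_forall fun x => ?_))
  simp only [RCLike.im_to_complex, Complex.im_mul_ofReal, Complex.exp_ofReal_mul_I_im]

namespace Real

theorem tendsto_integral_sinc_odd_mul_pi_div_two :
    Tendsto (fun n : ℕ => ∫ x in (0 : ℝ)..(2 * n + 1) * (π / 2), sinc x) atTop (𝓝 (π / 2)) := by
  have hpi : 0 ≤ π / 2 := by positivity
  have hker : ∀ n : ℕ, ∃ K : ℝ → ℝ, Continuous K ∧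
      (∀ θ, sin θ * K θ = sin ((2 * n + 1) * θ)) ∧ ∫ θ in (0 : ℝ)..π / 2, K θ = π / 2 := by
    intro n
    induction n with
    | zero => exact ⟨fun _ => 1, continuous_const, by simp, by simp⟩
    | succ n ih =>
      obtain ⟨K, hK, hmul, hint⟩ := ih
      refine ⟨fun θ => K θ + 2 * cos ((2 * n + 2) * θ), by fun_prop, fun θ => ?_, ?_⟩
      · rw [mul_add, hmul, mul_left_comm, ← mul_assoc, two_mul_sin_mul_cos,
          show θ - (2 * n + 2) * θ = -((2 * n + 1) * θ) by ring, sin_neg]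
        push_cast
        ring_nf
      · rw [intervalIntegral.integral_add (hK.intervalIntegrable _ _)
          (by apply Continuous.intervalIntegrable; fun_prop), hint,
          intervalIntegral.integral_const_mul,
          intervalIntegral.integral_comp_mul_left (fun x => cos x) (by positivity), integral_cos,
          show (2 * (n : ℝ) + 2) * (π / 2) = ((n + 1 : ℕ) : ℝ) * π by push_cast; ring,
          sin_nat_mul_pi]
        simp
  have hbound : IntegrableOn (fun θ : ℝ => 1 / sin θ - 1 / θ) (Ioo 0 (π / 2)) := by
    refine Measure.integrableOn_of_bounded (M := π) (by simp) ?_ ?_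
    · fun_prop
    · refine (ae_restrict_iff' measurableSet_Ioo).2 (Eventually.of_forall fun θ ⟨h0, h1⟩ => ?_)
      have hs : 0 < sin θ := sin_pos_of_pos_of_lt_pi h0 (by linarith)
      have hjordan := mul_le_sin h0.le h1.le
      have hle := sin_le h0.le
      have hcos := one_sub_sq_div_two_le_cos (x := θ)
      have htan := lt_tan h0 h1
      have hc : 0 < cos θ := cos_pos_of_mem_Ioo ⟨by linarith, h1⟩
      rw [tan_eq_sin_div_cos, lt_div_iff₀ hc] at htan
      have hpi4 : π ≤ 4 := pi_le_four
      rw [div_sub_div _ _ hs.ne' h0.ne', norm_eq_abs,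
        abs_of_nonneg (div_nonneg (by linarith) (by positivity)), div_le_iff₀ (by positivity)]
      have h2 : 2 * θ ≤ π * sin θ := by
        have := mul_le_mul_of_nonneg_left hjordan pi_pos.le
        calc 2 * θ = π * (2 / π * θ) := by field_simp
          _ ≤ _ := this
      have h3 : θ * (1 - θ ^ 2 / 2) ≤ θ * cos θ := mul_le_mul_of_nonneg_left hcos h0.le
      have h4 : 2 * θ * θ ≤ π * sin θ * θ := mul_le_mul_of_nonneg_right h2 h0.le
      have h5 : θ ^ 2 * θ ≤ θ ^ 2 * 2 := mul_le_mul_of_nonneg_left (by linarith) (by positivity)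
      nlinarith
  have hRL := (tendsto_setIntegral_sin_mul_atTop measurableSet_Ioo hbound).comp
    (tendsto_atTop_add_const_right atTop (1 : ℝ)
      (tendsto_natCast_atTop_atTop.const_mul_atTop (two_pos (α := ℝ))))
  have hsub := (tendsto_const_nhds (x := π / 2)).sub hRL
  rw [sub_zero] at hsub
  refine hsub.congr fun n => ?_
  obtain ⟨K, hK, hmul, hint⟩ := hker n
  have hn : (2 * (n : ℝ) + 1) ≠ 0 := by positivity
  have hS : Continuous fun θ => (2 * n + 1) * sinc ((2 * n + 1) * θ) := by fun_prop
  have hscale : ∫ x in (0 : ℝ)..(2 * n + 1) * (π / 2), sinc x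
      = ∫ θ in (0 : ℝ)..π / 2, (2 * n + 1) * sinc ((2 * n + 1) * θ) := by
    rw [intervalIntegral.integral_const_mul, intervalIntegral.mul_integral_comp_mul_left]
    simp
  have hdiff : ∫ x in Ioo 0 (π / 2), sin ((2 * (n : ℝ) + 1) * x) * (1 / sin x - 1 / x)
      = ∫ θ in (0 : ℝ)..π / 2, (K θ - (2 * n + 1) * sinc ((2 * n + 1) * θ)) := by
    rw [intervalIntegral.integral_of_le hpi, integral_Ioc_eq_integral_Ioo]
    refine setIntegral_congr_fun measurableSet_Ioo fun θ ⟨h0, h1⟩ => ?_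
    have hs : sin θ ≠ 0 := (sin_pos_of_pos_of_lt_pi h0 (by linarith)).ne'
    rw [sinc_of_ne_zero (mul_ne_zero hn h0.ne'), ← hmul]
    field_simp
  simp only [Function.comp_apply]
  rw [hdiff, intervalIntegral.integral_sub (hK.intervalIntegrable _ _)
    (hS.intervalIntegrable _ _), hint, ← hscale]
  ring

/-- The **Dirichlet integral**. -/
theorem tendsto_integral_sinc_atTop :
    Tendsto (fun T => ∫ x in (0 : ℝ)..T, sinc x) atTop (𝓝 (π / 2)) := by
  have hfloor : Tendsto (fun T : ℝ => ⌊T / π⌋₊) atTop atTop :=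
    tendsto_nat_floor_atTop.comp (tendsto_id.atTop_div_const pi_pos)
  have hodd := tendsto_integral_sinc_odd_mul_pi_div_two.comp hfloor
  have hrem : Tendsto (fun T : ℝ =>
      ∫ x in (2 * (⌊T / π⌋₊ : ℝ) + 1) * (π / 2)..T, sinc x) atTop (𝓝 0) := by
    refine squeeze_zero_norm' (a := fun T : ℝ => 1 / (⌊T / π⌋₊ : ℝ)) ?_
      ((tendsto_one_div_atTop_nhds_zero_nat (𝕜 := ℝ)).comp hfloor)
    filter_upwards [hfloor.eventually_gt_atTop 0, eventually_ge_atTop 0] with T hn hT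
    set n := ⌊T / π⌋₊
    have hn' : (0 : ℝ) < n := by exact_mod_cast hn
    have hlow : n * π ≤ T := (le_div_iff₀ pi_pos).1 (Nat.floor_le (by positivity))
    have hup : T < (n + 1) * π := (div_lt_iff₀ pi_pos).1 (Nat.lt_floor_add_one _)
    have hmid : n * π ≤ (2 * (n : ℝ) + 1) * (π / 2) := by nlinarith [pi_pos]
    have hnpi : 0 < n * π := by positivity
    refine (intervalIntegral.norm_integral_le_of_norm_le_const (C := 1 / (n * π))
      fun x hx => ?_).trans ?_
    · have hx' : n * π ≤ x := (le_min hmid hlow).trans hx.1.le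
      rw [sinc_of_ne_zero (by linarith), norm_eq_abs, abs_div, abs_of_pos (by linarith : 0 < x)]
      exact div_le_div₀ zero_le_one (abs_sin_le_one x) hnpi hx'
    · have : |T - (2 * (n : ℝ) + 1) * (π / 2)| ≤ π := by
        rw [abs_le]; constructor <;> nlinarith [pi_pos]
      calc 1 / (n * π) * |T - (2 * (n : ℝ) + 1) * (π / 2)| ≤ 1 / (n * π) * π := by gcongr
        _ = 1 / (n : ℝ) := by field_simp
  have hsum := hodd.add hrem
  rw [add_zero] at hsum
  refine hsum.congr fun T => ?_
  exact intervalIntegral.integral_add_adjacent_intervals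
    (continuous_sinc.intervalIntegrable _ _) (continuous_sinc.intervalIntegrable _ _)

theorem integral_cos_pow_even_zero_pi_div_two (n : ℕ) :
    ∫ θ in (0 : ℝ)..π / 2, cos θ ^ (2 * n)
      = π / 2 * ((2 * n).factorial / (4 ^ n * (n.factorial * n.factorial))) := by
  rw [EulerSine.integral_cos_pow_eq, integral_sin_pow_even]
  have : ∏ i ∈ Finset.range n, (2 * (i : ℝ) + 1) / (2 * i + 2)
      = (2 * n).factorial / (4 ^ n * (n.factorial * n.factorial)) := by
    induction n with
    | zero => simp
    | succ n ih =>
      rw [Finset.prod_range_succ, ih, show 2 * (n + 1) = 2 * n + 1 + 1 by ring,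
        Nat.factorial_succ, Nat.factorial_succ, Nat.factorial_succ]
      push_cast
      field_simp
      ring
  rw [this]
  ring

end Real

open Real

/-- **Bessel's integral** for the function of order zero. -/
theorem besselJ_zero_eq_integral (x : ℝ) :
    besselJ 0 x = 2 / π * ∫ θ in (0 : ℝ)..π / 2, cos (x * cos θ) := by
  have hsummable : Summable fun n : ℕ => |x| ^ (2 * n) / (2 * n).factorial :=
    (hasSum_cosh |x|).summable
  have h := intervalIntegral.hasSum_integral_of_dominated_convergence (μ := volume)
    (a := 0) (b := π / 2)
    (F := fun (n : ℕ) θ => (-1 : ℝ) ^ n * (x * cos θ) ^ (2 * n) / (2 * n).factorial)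
    (f := fun θ => cos (x * cos θ))
    (fun n _ => |x| ^ (2 * n) / (2 * n).factorial)
    (fun n => by apply Continuous.aestronglyMeasurable; fun_prop)
    (fun n => Eventually.of_forall fun θ _ => by
      rw [norm_eq_abs, abs_div, abs_mul, abs_pow, abs_pow, abs_mul, Nat.abs_cast, abs_neg,
        abs_one, one_pow, one_mul]
      gcongr
      exact mul_le_of_le_one_right (abs_nonneg x) (abs_cos_le_one θ))
    (Eventually.of_forall fun _ _ => hsummable)
    intervalIntegrable_const
    (Eventually.of_forall fun θ _ => hasSum_cos (x * cos θ))
  rw [← (h.mul_left (2 / π)).tsum_eq, besselJ]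
  refine tsum_congr fun n => ?_
  have hterm : ∀ θ, (-1 : ℝ) ^ n * (x * cos θ) ^ (2 * n) / (2 * n).factorial
      = (-1 : ℝ) ^ n * x ^ (2 * n) / (2 * n).factorial * cos θ ^ (2 * n) := fun θ => by
    rw [mul_pow]; ring
  simp_rw [hterm]
  rw [intervalIntegral.integral_const_mul, integral_cos_pow_even_zero_pi_div_two, zero_add,
    zero_add, div_pow, pow_mul 2 2 n]
  norm_num
  field_simp

theorem intervalIntegral_besselJ_zero (T : ℝ) :
    ∫ x in (0 : ℝ)..T, besselJ 0 x
      = 2 / π * ∫ θ in (0 : ℝ)..π / 2, T * sinc (T * cos θ) := by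
  simp_rw [besselJ_zero_eq_integral]
  rw [intervalIntegral.integral_const_mul, intervalIntegral_intervalIntegral_swap]
  · congr 1
    refine intervalIntegral.integral_congr fun θ _ => ?_
    rcases eq_or_ne (cos θ) 0 with hc | hc
    · simp [hc]
    rcases eq_or_ne T 0 with rfl | hT
    · simp
    rw [intervalIntegral.integral_comp_mul_right (fun y => cos y) hc, integral_cos,
      sinc_of_ne_zero (mul_ne_zero hT hc)]
    simp
    field_simp
  · refine (ContinuousOn.integrableOn_compact (isCompact_uIcc.prod isCompact_uIcc) ?_).mono_set
      (prod_mono uIoc_subset_uIcc uIoc_subset_uIcc)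
    apply Continuous.continuousOn
    fun_prop

theorem tendsto_integral_mul_sinc_mul_one_sub_sin :
    Tendsto (fun T : ℝ => ∫ θ in (0 : ℝ)..π / 2, T * sinc (T * cos θ) * (1 - sin θ))
      atTop (𝓝 0) := by
  have hpi : 0 ≤ π / 2 := by positivity
  let h : ℝ → ℝ := fun u => (1 - √(1 - u ^ 2)) / (u * √(1 - u ^ 2))
  have hderiv : ∀ θ ∈ Ioo 0 (π / 2), HasDerivWithinAt cos (-sin θ) (Ioo 0 (π / 2)) θ :=
    fun θ _ => (hasDerivAt_cos θ).hasDerivWithinAt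
  have hinj : InjOn cos (Ioo 0 (π / 2)) := injOn_cos.mono
    (Ioo_subset_Icc_self.trans (Icc_subset_Icc_right (half_le_self pi_pos.le)))
  have hmeas : MeasurableSet (cos '' Ioo 0 (π / 2)) :=
    measurableSet_Ioo.image_of_continuousOn_injOn continuous_cos.continuousOn hinj
  have hpos : ∀ θ ∈ Ioo 0 (π / 2), 0 < sin θ ∧ 0 < cos θ := fun θ hθ =>
    ⟨sin_pos_of_pos_of_lt_pi hθ.1 (by linarith [hθ.2]),
      cos_pos_of_mem_Ioo ⟨by linarith [hθ.1], hθ.2⟩⟩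
  have hweight : ∀ θ ∈ Ioo 0 (π / 2), |-sin θ| * h (cos θ) = (1 - sin θ) / cos θ := by
    intro θ hθ
    obtain ⟨hs, hc⟩ := hpos θ hθ
    have hsqrt : √(1 - cos θ ^ 2) = sin θ := by
      rw [← sin_sq, sqrt_sq hs.le]
    simp only [h]
    rw [hsqrt, abs_neg, abs_of_pos hs]
    field_simp
  have hint : IntegrableOn h (cos '' Ioo 0 (π / 2)) := by
    rw [integrableOn_image_iff_integrableOn_abs_deriv_smul measurableSet_Ioo hderiv hinj]
    have hcont : ContinuousOn (fun θ => cos θ / (1 + sin θ)) (Icc 0 (π / 2)) := by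
      refine ContinuousOn.div (by fun_prop) (by fun_prop) fun θ hθ => ?_
      have := sin_nonneg_of_nonneg_of_le_pi hθ.1 (by linarith [hθ.2])
      positivity
    refine (hcont.integrableOn_Icc.mono_set Ioo_subset_Icc_self).congr_fun
      (fun θ hθ => ?_) measurableSet_Ioo
    obtain ⟨hs, hc⟩ := hpos θ hθ
    simp only [smul_eq_mul]
    rw [hweight θ hθ, div_eq_div_iff (by positivity) hc.ne']
    nlinarith [sin_sq_add_cos_sq θ]
  refine (tendsto_setIntegral_sin_mul_atTop hmeas hint).congr' ?_
  filter_upwards [eventually_gt_atTop 0] with T hT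
  rw [integral_image_eq_integral_abs_deriv_smul measurableSet_Ioo hderiv hinj,
    intervalIntegral.integral_of_le hpi, integral_Ioc_eq_integral_Ioo]
  refine setIntegral_congr_fun measurableSet_Ioo fun θ hθ => ?_
  obtain ⟨hs, hc⟩ := hpos θ hθ
  simp only [smul_eq_mul]
  rw [mul_left_comm, hweight θ hθ, sinc_of_ne_zero (by positivity)]
  field_simp

theorem integral_mul_sinc_mul_cos_mul_sin (T : ℝ) :
    ∫ θ in (0 : ℝ)..π / 2, T * sinc (T * cos θ) * sin θ = ∫ x in (0 : ℝ)..T, sinc x := by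
  have h := intervalIntegral.integral_comp_mul_deriv (a := 0) (b := π / 2)
    (f := fun θ => T * cos θ) (f' := fun θ => T * -sin θ) (g := sinc)
    (fun θ _ => (hasDerivAt_cos θ).const_mul T) (by fun_prop) continuous_sinc
  simp only [Function.comp_apply, cos_zero, cos_pi_div_two, mul_zero, mul_one] at h
  rw [intervalIntegral.integral_symm T 0, ← h, ← intervalIntegral.integral_neg]
  congr 1 with θ
  ring

theorem integral_besselJ_zero :
    Filter.Tendsto (fun T => ∫ x in (0:ℝ)..T, besselJ 0 x)
      Filter.atTop (nhds 1) := by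
  have h := ((tendsto_integral_sinc_atTop.add
    tendsto_integral_mul_sinc_mul_one_sub_sin).const_mul (2 / π))
  rw [add_zero, div_mul_div_cancel₀ pi_ne_zero, div_self two_ne_zero] at h
  refine h.congr fun T => ?_
  rw [intervalIntegral_besselJ_zero, ← integral_mul_sinc_mul_cos_mul_sin,
    ← intervalIntegral.integral_add]
  · congr 2 with θ
    ring
  all_goals
    apply Continuous.intervalIntegrable
    fun_prop
end

section
/- For every real number b, ∫_{0}^{∞} e^{-x²} J₀(b x) dx = (√π / 2) · e^{-b²/8} · I₀(b²/8). -/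
/-- The modified Bessel function of order zero:
`I₀(x) = ∑_{r=0}^∞ (x/2)^{2r} / (r!)²`. -/
noncomputable def besselI0 (x : ℝ) : ℝ :=
  ∑' r : ℕ, (x / 2) ^ (2 * r) / (r.factorial : ℝ) ^ 2

/-- The coefficient of `X ^ n` in `(X ^ 2 + 1) ^ n`. -/
lemma coeff_X_sq_add_one_pow_self (n : ℕ) :
    ((Polynomial.X ^ 2 + 1 : Polynomial ℕ) ^ n).coeff n =
      if Even n then n.choose (n / 2) else 0 := by
  rw [show (Polynomial.X ^ 2 + 1 : Polynomial ℕ) ^ n =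
    Polynomial.expand ℕ 2 ((1 + Polynomial.X) ^ n) by simp [add_comm],
    Polynomial.coeff_expand (by norm_num), Polynomial.coeff_one_add_X_pow]
  simp [even_iff_two_dvd]

/-- The central binomial coefficient from comparing coefficients in
`(1 + X) ^ (2 * n) = ((X ^ 2 + 1) + 2 * X) ^ n`. -/
lemma sum_antidiagonal_choose_mul_central (n : ℕ) :
    ∑ p ∈ Finset.HasAntidiagonal.antidiagonal n,
      n.choose p.1 * (if Even p.1 then p.1.choose (p.1 / 2) else 0) * 2 ^ p.2 =
      (2 * n).choose n := by
  have h : (1 + Polynomial.X : Polynomial ℕ) ^ (2 * n) =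
      ((Polynomial.X ^ 2 + 1) + Polynomial.C 2 * Polynomial.X) ^ n := by
    rw [pow_mul]
    congr 1
    simp only [map_ofNat]
    ring
  have h2 := congrArg (fun p => Polynomial.coeff p n) h
  simp only [Polynomial.coeff_one_add_X_pow, Nat.cast_id] at h2
  rw [h2, (Commute.all _ _).add_pow', Polynomial.finsetSum_coeff]
  refine Finset.sum_congr rfl fun p hp => ?_
  obtain ⟨i, j⟩ := p
  obtain rfl : i + j = n := by simpa using hp
  rw [← coeff_X_sq_add_one_pow_self, mul_pow, ← Polynomial.C_pow, mul_left_comm, nsmul_eq_mul,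
    ← Polynomial.C_eq_natCast, Polynomial.coeff_C_mul, Polynomial.coeff_C_mul,
    Polynomial.coeff_mul_X_pow]
  simp
  ring

lemma summable_sq_pow_div_factorial_sq (x : ℝ) :
    Summable fun r : ℕ => x ^ (2 * r) / (r.factorial : ℝ) ^ 2 := by
  refine Summable.of_nonneg_of_le (fun r => ?_) (fun r => ?_)
    (Real.summable_pow_div_factorial (x ^ 2))
  · rw [pow_mul]
    positivity
  · rw [pow_mul]
    have : (1 : ℝ) ≤ r.factorial := by exact_mod_cast Nat.one_le_iff_ne_zero.2 r.factorial_ne_zero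
    gcongr
    nlinarith

/-- The power series of `exp (-z) * I₀(z)`. -/
lemma besselI0_mul_exp_neg (z : ℝ) :
    besselI0 z * Real.exp (-z) =
      ∑' n : ℕ, (-z / 2) ^ n * ((2 * n).choose n : ℝ) / n.factorial := by
  set f : ℕ → ℝ := fun m => if Even m then (z / 2) ^ m / ((m / 2).factorial : ℝ) ^ 2 else 0
    with hf
  have hinj : Function.Injective fun r : ℕ => 2 * r := fun a b h => by simpa using h
  have hcomp : (f ∘ fun r => 2 * r) = fun r => (z / 2) ^ (2 * r) / (r.factorial : ℝ) ^ 2 := by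
    ext r
    simp [hf]
  have hout : ∀ m ∉ Set.range (fun r : ℕ => 2 * r), f m = 0 := fun m hm => by
    refine if_neg fun he => hm ?_
    obtain ⟨r, rfl⟩ := he
    exact ⟨r, by ring⟩
  have hsum : Summable f := by
    rw [← hinj.summable_iff hout, hcomp]
    exact summable_sq_pow_div_factorial_sq _
  have hI : besselI0 z = ∑' m, f m := by
    rw [← hinj.tsum_eq (Function.support_subset_iff'.2 hout)]
    exact tsum_congr fun r => (congrFun hcomp r).symm
  have hE : Real.exp (-z) = ∑' k : ℕ, (-z) ^ k / (k.factorial : ℝ) := by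
    rw [Real.exp_eq_exp_ℝ]
    exact (NormedSpace.expSeries_div_hasSum_exp (-z)).tsum_eq.symm
  rw [hI, hE, tsum_mul_tsum_eq_tsum_sum_antidiagonal_of_summable_norm hsum.norm
    (Real.summable_pow_div_factorial (-z)).norm]
  refine tsum_congr fun n => ?_
  rw [← sum_antidiagonal_choose_mul_central, Nat.cast_sum, Finset.mul_sum, Finset.sum_div]
  refine Finset.sum_congr rfl fun p hp => ?_
  obtain ⟨i, k⟩ := p
  obtain rfl : i + k = n := by simpa using hp
  by_cases he : Even i
  · obtain ⟨r, rfl⟩ := he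
    have hr : (r + r) / 2 = r := by omega
    have h2 : (-z / 2) ^ (r + r) = (z / 2) ^ (r + r) := by
      rw [neg_div, Even.neg_pow ⟨r, rfl⟩]
    simp only [hf, Even.add_self, if_true, hr]
    push_cast
    rw [Nat.cast_add_choose, Nat.cast_add_choose, pow_add (-z / 2) (r + r) k, h2, div_pow (-z)]
    field_simp
  · simp [hf, he]

lemma integral_pow_mul_exp_neg_sq (r : ℕ) :
    ∫ x in Set.Ioi (0 : ℝ), x ^ (2 * r) * Real.exp (-x ^ 2) =
      Real.sqrt Real.pi / 2 * ((2 * r).factorial / (4 ^ r * r.factorial)) := by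
  have hG : Real.Gamma (r + 1 / 2) =
      Real.sqrt Real.pi * ((2 * r).factorial / (4 ^ r * r.factorial)) := by
    induction r with
    | zero => simp [Real.Gamma_one_half_eq, -one_div]
    | succ r ih =>
      rw [show ((r + 1 : ℕ) : ℝ) + 1 / 2 = (r + 1 / 2) + 1 by push_cast; ring,
        Real.Gamma_add_one (by positivity), ih, show 2 * (r + 1) = 2 * r + 1 + 1 by ring]
      simp only [Nat.factorial_succ]
      push_cast
      field_simp
      ring
  have h := integral_rpow_mul_exp_neg_rpow (p := 2) (q := ((2 * r : ℕ) : ℝ)) (by norm_num)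
    (lt_of_lt_of_le (by norm_num) (Nat.cast_nonneg _))
  simp only [Real.rpow_natCast, Real.rpow_two] at h
  rw [h, show (((2 * r : ℕ) : ℝ) + 1) / 2 = r + 1 / 2 by push_cast; ring, hG]
  ring

lemma integrableOn_pow_mul_exp_neg_sq (n : ℕ) :
    MeasureTheory.IntegrableOn (fun x : ℝ => x ^ n * Real.exp (-x ^ 2)) (Set.Ioi 0) := by
  simpa using integrableOn_rpow_mul_exp_neg_mul_sq (b := 1) one_pos (s := (n : ℝ))
    (lt_of_lt_of_le (by norm_num) (Nat.cast_nonneg _))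

theorem integral_gaussian_besselJ (b : ℝ) :
    ∫ x in Set.Ioi (0:ℝ), Real.exp (-x ^ 2) * besselJ 0 (b * x) =
      Real.sqrt Real.pi / 2 * Real.exp (-b ^ 2 / 8) * besselI0 (b ^ 2 / 8) := by
  set c : ℕ → ℝ := fun r => (-1) ^ r / (r.factorial : ℝ) ^ 2 * (b / 2) ^ (2 * r) with hc
  set F : ℕ → ℝ → ℝ := fun r x => c r * (x ^ (2 * r) * Real.exp (-x ^ 2)) with hF
  have hnorm : ∀ r x, ‖F r x‖ = |c r| * (x ^ (2 * r) * Real.exp (-x ^ 2)) := fun r x => by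
    rw [hF, norm_mul, Real.norm_eq_abs, Real.norm_of_nonneg]
    rw [pow_mul]
    positivity
  have hcabs : ∀ r, |c r| = (b ^ 2 / 4) ^ r / (r.factorial : ℝ) ^ 2 := fun r => by
    simp only [hc]
    have h : (b / 2) ^ (2 * r) = (b ^ 2 / 4) ^ r := by rw [pow_mul]; ring
    rw [h, abs_mul, abs_div, abs_pow, abs_neg, abs_one, one_pow, abs_of_nonneg (by positivity),
      abs_of_nonneg (by positivity)]
    ring
  have hchoose : ∀ r : ℕ, ((2 * r).choose r : ℝ) = (2 * r).factorial / (r.factorial) ^ 2 :=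
    fun r => by rw [two_mul, Nat.cast_add_choose, sq]
  have hsum : Summable fun r => ∫ x in Set.Ioi (0 : ℝ), ‖F r x‖ := by
    simp only [hnorm, MeasureTheory.integral_const_mul, integral_pow_mul_exp_neg_sq, hcabs]
    refine Summable.of_nonneg_of_le (fun r => by positivity) (fun r => ?_)
      ((Real.summable_pow_div_factorial (b ^ 2 / 4)).mul_left (Real.sqrt Real.pi / 2))
    have h4 : ((2 * r).choose r : ℝ) ≤ 4 ^ r := by
      have := Nat.choose_le_two_pow (2 * r) r
      rw [pow_mul] at this
      exact_mod_cast this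
    calc _ = Real.sqrt Real.pi / 2 * ((b ^ 2 / 4) ^ r / r.factorial *
          (((2 * r).choose r : ℝ) / 4 ^ r)) := by rw [hchoose]; field_simp
      _ ≤ Real.sqrt Real.pi / 2 * ((b ^ 2 / 4) ^ r / r.factorial * 1) := by
        gcongr
        exact div_le_one_of_le₀ h4 (by positivity)
      _ = _ := by rw [mul_one]
  have hint := (MeasureTheory.hasSum_integral_of_summable_integral_norm
    (fun r => (integrableOn_pow_mul_exp_neg_sq (2 * r)).const_mul (c r)) hsum).tsum_eq
  have hlhs : ∀ x, Real.exp (-x ^ 2) * besselJ 0 (b * x) = ∑' r, F r x := fun x => by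
    rw [besselJ, ← tsum_mul_left]
    refine tsum_congr fun r => ?_
    simp only [hF, hc, zero_add]
    rw [mul_div_right_comm b x 2, mul_pow]
    ring
  simp only [hlhs]
  rw [← hint, mul_assoc, mul_comm (Real.exp _), neg_div, besselI0_mul_exp_neg, ← tsum_mul_left]
  refine tsum_congr fun r => ?_
  rw [MeasureTheory.integral_const_mul, integral_pow_mul_exp_neg_sq, hchoose]
  have : (-(b ^ 2 / 8) / 2) ^ r = (-1) ^ r * (b / 2) ^ (2 * r) / 4 ^ r := by
    rw [pow_mul, ← mul_pow, ← div_pow]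
    ring
  rw [this, hc]
  field_simp
end

section
/- For every real x > 0, the function T ↦ ∫_{0}^{T} J₀(2√(x u)) sin(u) du tends to cos(x) as T → ∞. -/
/-- The entire function `∑ (-t)^r / (r! (n+r)!)` (a Bessel–Clifford function). -/
noncomputable def besselClifford (n : ℕ) (t : ℝ) : ℝ :=
  ∑' r : ℕ, (-1 : ℝ) ^ r / (r.factorial * (n + r).factorial) * t ^ r

lemma abs_besselClifford_coeff_le (n r : ℕ) :
    |(-1 : ℝ) ^ r / (r.factorial * (n + r).factorial)| ≤ 1 / r.factorial := by
  rw [abs_div, abs_pow, abs_neg, abs_one, one_pow, abs_of_pos (by positivity)]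
  have h : (1 : ℝ) ≤ (n + r).factorial := by exact_mod_cast Nat.factorial_pos _
  gcongr
  exact le_mul_of_one_le_right (by positivity) h

lemma summable_besselClifford (n : ℕ) (t : ℝ) :
    Summable fun r : ℕ => (-1 : ℝ) ^ r / (r.factorial * (n + r).factorial) * t ^ r := by
  refine Summable.of_norm_bounded (Real.summable_pow_div_factorial |t|) fun r => ?_
  rw [Real.norm_eq_abs, abs_mul, abs_pow, div_eq_inv_mul (|t| ^ r), ← one_div]
  gcongr
  exact abs_besselClifford_coeff_le n r

lemma hasDerivAt_besselClifford (n : ℕ) (t : ℝ) :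
    HasDerivAt (besselClifford n) (-besselClifford (n + 1) t) t := by
  have hs : Summable fun r : ℕ => 1 / (r.factorial : ℝ) * (r * (|t| + 1) ^ (r - 1)) := by
    rw [← summable_nat_add_iff 1]
    refine (Real.summable_pow_div_factorial (|t| + 1)).congr fun r => ?_
    rw [Nat.factorial_succ]
    push_cast
    field_simp
  have hd := hasDerivAt_tsum_of_isPreconnected
    (g := fun (r : ℕ) (y : ℝ) => (-1 : ℝ) ^ r / (r.factorial * (n + r).factorial) * y ^ r)
    (g' := fun (r : ℕ) (y : ℝ) =>
      (-1 : ℝ) ^ r / (r.factorial * (n + r).factorial) * (r * y ^ (r - 1)))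
    hs Metric.isOpen_ball (convex_ball (0 : ℝ) (|t| + 1)).isPreconnected
    (fun r y _ => (hasDerivAt_pow r y).const_mul _)
    (fun r y hy => by
      have hy' : |y| ≤ |t| + 1 := by
        simpa using (mem_ball_zero_iff.mp hy).le
      rw [Real.norm_eq_abs, abs_mul, abs_mul, abs_pow, Nat.abs_cast]
      gcongr
      exact abs_besselClifford_coeff_le n r)
    (Metric.mem_ball_self (by positivity)) (summable_besselClifford n 0)
    (y := t) (by simp)
  refine hd.congr_deriv ?_
  have hs' : Summable fun r : ℕ =>
      (-1 : ℝ) ^ r / (r.factorial * (n + r).factorial) * (r * t ^ (r - 1)) := by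
    refine Summable.of_norm_bounded hs fun r => ?_
    rw [Real.norm_eq_abs, abs_mul, abs_mul, abs_pow, Nat.abs_cast]
    gcongr
    · exact abs_besselClifford_coeff_le n r
    · linarith
  rw [hs'.tsum_eq_zero_add, besselClifford, ← tsum_neg]
  simp only [Nat.cast_zero, zero_mul, mul_zero, zero_add]
  refine tsum_congr fun r => ?_
  rw [Nat.factorial_succ, pow_succ, Nat.add_sub_cancel, show n + (r + 1) = n + 1 + r by ring]
  push_cast
  field_simp

lemma continuous_besselClifford (n : ℕ) : Continuous (besselClifford n) :=
  continuous_iff_continuousAt.mpr fun t => (hasDerivAt_besselClifford n t).continuousAt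

lemma besselClifford_zero_right (n : ℕ) : besselClifford n 0 = 1 / n.factorial := by
  rw [besselClifford, tsum_eq_single 0 (by intro r hr; simp [hr])]
  simp

lemma besselClifford_recurrence (t : ℝ) :
    besselClifford 1 t - t * besselClifford 2 t = besselClifford 0 t := by
  have h0 := summable_besselClifford 0 t
  have h1 := summable_besselClifford 1 t
  have h2 := (summable_besselClifford 2 t).mul_left t
  have h1' := (summable_nat_add_iff 1).mpr h1
  unfold besselClifford
  rw [h0.tsum_eq_zero_add, h1.tsum_eq_zero_add, ← tsum_mul_left, add_sub_assoc,
    ← h1'.tsum_sub h2]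
  congr 1
  refine tsum_congr fun r => ?_
  rw [show 1 + (r + 1) = r + 1 + 1 by ring, show 2 + r = r + 1 + 1 by ring, zero_add,
    Nat.factorial_succ (r + 1), Nat.factorial_succ r]
  push_cast
  field_simp
  ring

lemma besselJ_zero_two_mul_sqrt {t : ℝ} (ht : 0 ≤ t) :
    besselJ 0 (2 * √t) = besselClifford 0 t := by
  refine tsum_congr fun r => ?_
  rw [mul_div_cancel_left₀ _ two_ne_zero, zero_add, zero_add, pow_mul, Real.sq_sqrt ht]

/-- The energy `f² + t f'²` of `f = besselClifford 0`, a solution of `t f'' + f' + f = 0`,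
decreases from its value `1` at `0`. -/
lemma abs_besselClifford_zero_le_one {t : ℝ} (ht : 0 ≤ t) : |besselClifford 0 t| ≤ 1 := by
  have hd (s : ℝ) : HasDerivAt (fun s => besselClifford 0 s ^ 2 + s * besselClifford 1 s ^ 2)
      (-besselClifford 1 s ^ 2) s := by
    refine (((hasDerivAt_besselClifford 0 s).fun_pow 2).fun_add
      ((hasDerivAt_id s).fun_mul ((hasDerivAt_besselClifford 1 s).fun_pow 2))).congr_deriv ?_
    simp only [← besselClifford_recurrence s, id, zero_add, Nat.reduceAdd, Nat.cast_ofNat]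
    ring
  have h := antitone_of_hasDerivAt_nonpos hd
    (fun s => neg_nonpos.mpr (sq_nonneg (besselClifford 1 s))) ht
  simp only [besselClifford_zero_right] at h
  rw [← sq_le_one_iff_abs_le_one]
  norm_num at h
  nlinarith [mul_nonneg ht (sq_nonneg (besselClifford 1 t))]

lemma tendsto_besselClifford_zero_atTop :
    Filter.Tendsto (besselClifford 0) Filter.atTop (nhds 0) := by
  set f := besselClifford 0
  set g := besselClifford 1
  let G : ℝ → ℝ := fun s =>
    √s * (f s ^ 2 + s * g s ^ 2) - √s / 2 * (f s * g s) + f s ^ 2 / (8 * √s)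
  have hf (s : ℝ) : HasDerivAt f (-g s) s := hasDerivAt_besselClifford 0 s
  have hg (s : ℝ) : HasDerivAt g (-besselClifford 2 s) s := hasDerivAt_besselClifford 1 s
  have hd (s : ℝ) (hs : 0 < s) : HasDerivAt G (-(f s ^ 2 / (16 * (s * √s)))) s := by
    have hr := Real.hasDerivAt_sqrt hs.ne'
    have hq : 0 < √s := Real.sqrt_pos.mpr hs
    refine ((hr.fun_mul (((hf s).fun_pow 2).fun_add
      ((hasDerivAt_id s).fun_mul ((hg s).fun_pow 2)))).fun_sub
      ((hr.div_const 2).fun_mul ((hf s).fun_mul (hg s))) |>.fun_add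
      (((hf s).fun_pow 2).fun_div (hr.const_mul 8) (by positivity))).congr_deriv ?_
    have hrec : besselClifford 2 s = (g s - f s) / s := by
      rw [eq_div_iff hs.ne']; linarith [besselClifford_recurrence s]
    simp only [hrec, id]
    obtain ⟨q, hq', rfl⟩ : ∃ q, 0 < q ∧ s = q ^ 2 := ⟨√s, hq, (Real.sq_sqrt hs.le).symm⟩
    rw [Real.sqrt_sq hq'.le]
    generalize f (q ^ 2) = a
    generalize g (q ^ 2) = b
    field_simp
    ring
  have hG : AntitoneOn G (Set.Ici 1) := by
    refine antitoneOn_of_hasDerivWithinAt_nonpos (convex_Ici 1)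
      (f' := fun s => -(f s ^ 2 / (16 * (s * √s)))) ?_ ?_ ?_
    · exact fun s hs => (hd s (zero_lt_one.trans_le hs)).continuousAt.continuousWithinAt
    · intro s hs
      rw [interior_Ici] at hs
      exact (hd s (zero_lt_one.trans hs)).hasDerivWithinAt
    · intro s hs
      rw [interior_Ici] at hs
      have : 0 < s := zero_lt_one.trans hs
      rw [neg_nonpos]
      positivity
  have hbound : ∀ s ≥ (1 : ℝ), f s ^ 2 ≤ 4 / 3 * G 1 / √s := by
    intro s hs
    have hq : 0 < √s := Real.sqrt_pos.mpr (by linarith)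
    have h1 : G s ≤ G 1 := hG (Set.mem_Ici.mpr le_rfl) hs hs
    have h2 : 0 ≤ f s ^ 2 / (8 * √s) := by positivity
    have h3 : 0 ≤ √s * ((f s - g s) ^ 2 + (s - 1) * g s ^ 2 + 3 * s * g s ^ 2) := by
      have : 0 ≤ s - 1 := by linarith
      have : 0 ≤ s := by linarith
      positivity
    rw [le_div_iff₀ hq]
    simp only [G] at h1 ⊢
    nlinarith
  have hlim : Filter.Tendsto (fun s => f s ^ 2) Filter.atTop (nhds 0) := by
    refine squeeze_zero' (Filter.Eventually.of_forall fun s => sq_nonneg _)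
      (Filter.eventually_atTop.mpr ⟨1, hbound⟩) ?_
    exact Real.tendsto_sqrt_atTop.const_div_atTop _
  rw [tendsto_zero_iff_abs_tendsto_zero]
  simpa [Function.comp_def, Real.sqrt_sq_eq_abs] using hlim.sqrt


open Complex in
/-- Differentiation under the integral sign, simplified by an integration by parts. -/
lemma hasDerivAt_integral_besselClifford_mul_exp (x t : ℝ) :
    HasDerivAt (fun s : ℝ => ∫ y in (0:ℝ)..x, (besselClifford 0 (y * s) : ℂ) * exp (I * y))
      (I * (x * besselClifford 1 (x * t) * exp (I * x)
        - ∫ y in (0:ℝ)..x, (besselClifford 0 (y * t) : ℂ) * exp (I * y))) t := by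
  have hc (n : ℕ) := continuous_besselClifford n
  obtain ⟨C, hC⟩ := ((isCompact_uIcc (a := (0:ℝ)) (b := x)).prod
    (isCompact_closedBall t 1)).exists_bound_of_continuousOn
    (f := fun p : ℝ × ℝ => -((p.1 * besselClifford 1 (p.1 * p.2) : ℂ) * exp (I * p.1)))
    (by fun_prop)
  have hparam := (intervalIntegral.hasDerivAt_integral_of_dominated_loc_of_deriv_le
    (μ := MeasureTheory.volume) (a := 0) (b := x) (bound := fun _ => C)
    (F := fun (s y : ℝ) => (besselClifford 0 (y * s) : ℂ) * exp (I * y))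
    (F' := fun (s y : ℝ) => -((y * besselClifford 1 (y * s) : ℂ) * exp (I * y)))
    (Metric.closedBall_mem_nhds t one_pos)
    (Filter.Eventually.of_forall fun s => Continuous.aestronglyMeasurable (by fun_prop))
    (Continuous.intervalIntegrable (by fun_prop) _ _)
    (Continuous.aestronglyMeasurable (by fun_prop))
    (Filter.Eventually.of_forall fun y hy s hs => hC (y, s) ⟨Set.uIoc_subset_uIcc hy, hs⟩)
    intervalIntegrable_const
    (Filter.Eventually.of_forall fun y _ s _ => by
      have h := ((hasDerivAt_besselClifford 0 (y * s)).comp s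
        ((hasDerivAt_id s).const_mul y)).ofReal_comp.mul_const (exp (I * y))
      refine h.congr_deriv ?_
      push_cast
      ring)).2
  refine hparam.congr_deriv ?_
  have hparts : ∫ y in (0:ℝ)..x, ((besselClifford 0 (y * t) : ℂ) * exp (I * y)
      + I * ((y * besselClifford 1 (y * t) : ℂ) * exp (I * y)))
      = x * besselClifford 1 (x * t) * exp (I * x) := by
    rw [intervalIntegral.integral_eq_sub_of_hasDerivAt
      (f := fun y : ℝ => (y * besselClifford 1 (y * t) : ℂ) * exp (I * y)) _
      (Continuous.intervalIntegrable (by fun_prop) _ _)]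
    · simp
    intro y _
    have h1 := ((hasDerivAt_id y).mul ((hasDerivAt_besselClifford 1 (y * t)).comp y
      ((hasDerivAt_id y).mul_const t))).ofReal_comp
    have h2 := ((hasDerivAt_id y).ofReal_comp.const_mul I).cexp
    have h := h1.mul h2
    simp only [id, Pi.mul_apply, Function.comp_apply, ofReal_mul] at h
    refine h.congr_deriv ?_
    rw [← besselClifford_recurrence (y * t)]
    push_cast
    ring
  rw [← hparts, intervalIntegral.integral_add (Continuous.intervalIntegrable (by fun_prop) _ _)
    (Continuous.intervalIntegrable (by fun_prop) _ _), intervalIntegral.integral_const_mul,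
    intervalIntegral.integral_neg, add_sub_cancel_left, ← mul_assoc, I_mul_I, neg_one_mul]

open Complex in
/-- A symmetric relation between the truncated Laplace transforms of `besselClifford 0`
at the point `-I`. -/
lemma integral_besselClifford_mul_exp_symm (x t : ℝ) :
    exp (I * x) * (∫ u in (0:ℝ)..t, (besselClifford 0 (x * u) : ℂ) * exp (I * u))
      + exp (I * t) * (∫ y in (0:ℝ)..x, (besselClifford 0 (y * t) : ℂ) * exp (I * y))
      = I - I * exp (I * (x + t)) * besselClifford 0 (x * t) := by
  have hc := continuous_besselClifford 0
  have hd (s : ℝ) : HasDerivAt (fun t : ℝ =>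
      exp (I * x) * (∫ u in (0:ℝ)..t, (besselClifford 0 (x * u) : ℂ) * exp (I * u))
      + exp (I * t) * (∫ y in (0:ℝ)..x, (besselClifford 0 (y * t) : ℂ) * exp (I * y))
      + I * exp (I * (x + t)) * besselClifford 0 (x * t)) 0 s := by
    have h1 : HasDerivAt
        (fun t : ℝ => ∫ u in (0:ℝ)..t, (besselClifford 0 (x * u) : ℂ) * exp (I * u))
        ((besselClifford 0 (x * s) : ℂ) * exp (I * s)) s :=
      (Continuous.integral_hasStrictDerivAt (by fun_prop) 0 s).hasDerivAt
    have h2 := hasDerivAt_integral_besselClifford_mul_exp x s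
    have h3 : HasDerivAt (fun t : ℝ => exp (I * t)) (exp (I * s) * I) s := by
      simpa using ((hasDerivAt_id s).ofReal_comp.const_mul I).cexp
    have h4 : HasDerivAt (fun t : ℝ => exp (I * (x + t))) (exp (I * (x + s)) * I) s := by
      simpa using (((hasDerivAt_id s).ofReal_comp.const_add (x : ℂ)).const_mul I).cexp
    have h5 : HasDerivAt (fun t : ℝ => (besselClifford 0 (x * t) : ℂ))
        (-(x * besselClifford 1 (x * s))) s := by
      have h := ((hasDerivAt_besselClifford 0 (x * s)).comp s
        ((hasDerivAt_id s).const_mul x)).ofReal_comp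
      refine h.congr_deriv ?_
      push_cast
      ring
    refine (((h1.const_mul (exp (I * x))).fun_add (h3.fun_mul h2)).fun_add
      ((h4.const_mul I).fun_mul h5)).congr_deriv ?_
    rw [mul_add, exp_add]
    linear_combination (exp (I * x) * exp (I * s) * besselClifford 0 (x * s)) * I_sq
  have h := is_const_of_deriv_eq_zero (fun s => (hd s).differentiableAt) (fun s => (hd s).deriv) t 0
  have h0 : ∫ y in (0:ℝ)..x, exp (I * y) = (exp (I * x) - 1) / I := by
    simpa using integral_exp_mul_complex (a := 0) (b := x) I_ne_zero
  simp only [intervalIntegral.integral_same, mul_zero, besselClifford_zero_right, h0, ofReal_zero,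
    exp_zero, add_zero, zero_add, one_mul, mul_one, Nat.factorial_zero, Nat.cast_one, div_one,
    ofReal_one, div_I] at h
  linear_combination h

open Complex in
lemma tendsto_integral_besselClifford_mul_exp {x : ℝ} (hx : 0 < x) :
    Filter.Tendsto (fun T : ℝ => ∫ u in (0:ℝ)..T, (besselClifford 0 (x * u) : ℂ) * exp (I * u))
      Filter.atTop (nhds (I * exp (-(I * x)))) := by
  have hc := continuous_besselClifford 0
  have hexp (y : ℝ) : ‖exp (I * y)‖ = 1 := by rw [mul_comm, norm_exp_ofReal_mul_I]
  have hlim {y : ℝ} (hy : 0 < y) :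
      Filter.Tendsto (fun T : ℝ => (besselClifford 0 (y * T) : ℂ)) Filter.atTop (nhds 0) := by
    have h := tendsto_besselClifford_zero_atTop.comp (Filter.tendsto_id.const_mul_atTop hy)
    exact_mod_cast (continuous_ofReal.tendsto 0).comp h
  have hint : Filter.Tendsto
      (fun T : ℝ => ∫ y in (0:ℝ)..x, (besselClifford 0 (y * T) : ℂ) * exp (I * y))
      Filter.atTop (nhds 0) := by
    rw [show (0 : ℂ) = ∫ _ in (0:ℝ)..x, 0 from intervalIntegral.integral_zero.symm]
    refine intervalIntegral.tendsto_integral_filter_of_dominated_convergence (fun _ => 1)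
      (Filter.Eventually.of_forall fun T => Continuous.aestronglyMeasurable (by fun_prop)) ?_
      intervalIntegrable_const ?_
    · filter_upwards [Filter.eventually_ge_atTop 0] with T hT
      refine Filter.Eventually.of_forall fun y hy => ?_
      rw [Set.uIoc_of_le hx.le] at hy
      rw [norm_mul, hexp, mul_one, norm_real]
      exact abs_besselClifford_zero_le_one (mul_nonneg hy.1.le hT)
    · refine Filter.Eventually.of_forall fun y hy => ?_
      rw [Set.uIoc_of_le hx.le] at hy
      simpa using (hlim hy.1).mul_const (exp (I * y))
  have hb {f g : ℝ → ℂ} (hg : ∀ T, ‖g T‖ = 1) (hf : Filter.Tendsto f Filter.atTop (nhds 0)) :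
      Filter.Tendsto (fun T => g T * f T) Filter.atTop (nhds 0) := by
    rw [tendsto_zero_iff_norm_tendsto_zero] at hf ⊢
    simpa [hg] using hf
  have h1 := hb hexp hint
  have h2 := hb (g := fun T : ℝ => I * exp (I * (x + T)))
    (fun T => by rw [norm_mul, norm_I, one_mul, ← ofReal_add, hexp]) (hlim hx)
  have h := ((tendsto_const_nhds (x := I)).sub h2 |>.sub h1).mul_const (exp (-(I * x)))
  rw [sub_zero, sub_zero] at h
  refine h.congr fun T => ?_
  rw [← integral_besselClifford_mul_exp_symm x T, add_sub_cancel_right, mul_right_comm,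
    ← exp_add, add_neg_cancel, exp_zero, one_mul]

theorem integral_besselJ_sin (x : ℝ) (hx : 0 < x) :
    Filter.Tendsto (fun T => ∫ u in (0:ℝ)..T, besselJ 0 (2 * Real.sqrt (x * u)) * Real.sin u)
      Filter.atTop (nhds (Real.cos x)) := by
  have hc := continuous_besselClifford 0
  have h := (Complex.continuous_im.tendsto _).comp (tendsto_integral_besselClifford_mul_exp hx)
  have hx' : (Complex.I * Complex.exp (-(Complex.I * x))).im = Real.cos x := by
    simp [Complex.exp_re]
  rw [hx'] at h
  refine h.congr' ?_
  filter_upwards [Filter.eventually_ge_atTop 0] with T hT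
  rw [Function.comp_apply, ← Complex.imCLM_apply, ← ContinuousLinearMap.intervalIntegral_comp_comm _
    (Continuous.intervalIntegrable (by fun_prop) _ _)]
  refine intervalIntegral.integral_congr fun u hu => ?_
  rw [Set.uIcc_of_le hT] at hu
  simp only [besselJ_zero_two_mul_sqrt (mul_nonneg hx.le hu.1), Complex.imCLM_apply,
    Complex.im_ofReal_mul]
  simp [Complex.exp_im]
end

section
/- For every natural number n and every real x, the Borel-type integral of the n-th Tricomi function satisfies ∫_{0}^{∞} e^{-t} t^n C_n(x t) dt = e^{-x}. -/
/-- The Tricomi function of order `n`: `C_n(x) = ∑_{r=0}^∞ (-x)^r / (r! (r+n)!)`. -/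
noncomputable def tricomiC (n : ℕ) (x : ℝ) : ℝ :=
  ∑' r : ℕ, (-x) ^ r / (r.factorial * (r + n).factorial)

theorem integrableOn_exp_neg_mul_pow (k : ℕ) :
    MeasureTheory.IntegrableOn (fun t : ℝ => Real.exp (-t) * t ^ k) (Set.Ioi 0) := by
  simpa using Real.GammaIntegral_convergent (s := k + 1) (by positivity)

theorem integral_exp_neg_mul_pow (k : ℕ) :
    ∫ t in Set.Ioi (0:ℝ), Real.exp (-t) * t ^ k = k.factorial := by
  rw [← Real.Gamma_nat_eq_factorial, Real.Gamma_eq_integral (by positivity)]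
  simp

theorem borel_tricomi (n : ℕ) (x : ℝ) :
    ∫ t in Set.Ioi (0:ℝ), Real.exp (-t) * t ^ n * tricomiC n (x * t) = Real.exp (-x) := by
  let F : ℕ → ℝ → ℝ := fun r t =>
    (-x) ^ r / (r.factorial * (r + n).factorial) * (Real.exp (-t) * t ^ (r + n))
  have integral_norm (r : ℕ) :
      ∫ t in Set.Ioi (0:ℝ), ‖F r t‖ = |x| ^ r / r.factorial := by
    have h : ∀ t ∈ Set.Ioi (0:ℝ), ‖F r t‖ =
        |x| ^ r / (r.factorial * (r + n).factorial) * (Real.exp (-t) * t ^ (r + n)) := by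
      intro t ht
      simp [F, abs_of_pos (Set.mem_Ioi.mp ht)]
    rw [MeasureTheory.setIntegral_congr_fun measurableSet_Ioi h,
      MeasureTheory.integral_const_mul, integral_exp_neg_mul_pow]
    field_simp
  have integral_term (r : ℕ) :
      ∫ t in Set.Ioi (0:ℝ), F r t = (-x) ^ r / r.factorial := by
    rw [MeasureTheory.integral_const_mul, integral_exp_neg_mul_pow]
    field_simp
  have hasSum := MeasureTheory.hasSum_integral_of_summable_integral_norm (F := F)
    (fun r => (integrableOn_exp_neg_mul_pow (r + n)).const_mul _)
    (by simpa only [integral_norm] using Real.summable_pow_div_factorial |x|)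
  simp only [integral_term] at hasSum
  have tsum_eq (t : ℝ) :
      Real.exp (-t) * t ^ n * tricomiC n (x * t) = ∑' r, F r t := by
    rw [tricomiC, ← tsum_mul_left]
    refine tsum_congr fun r => ?_
    simp only [F, ← neg_mul, mul_pow, pow_add]
    ring
  simp only [tsum_eq]
  rw [← hasSum.tsum_eq, Real.exp_eq_exp_ℝ, NormedSpace.exp_eq_tsum_div]
end

section
/- For all real numbers x and σ, ∑_{n=0}^{∞} (σ^n / n!) C_n(x) = C₀(x - σ), where the series on the left converges. -/
open Finset in
theorem sum_antidiagonal_pow_div_factorial (a b : ℝ) (n : ℕ) :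
    ∑ p ∈ antidiagonal n, a ^ p.1 / p.1.factorial * (b ^ p.2 / p.2.factorial) =
      (a + b) ^ n / n.factorial := by
  rw [(Commute.all a b).add_pow', sum_div]
  refine sum_congr rfl fun p hp => ?_
  obtain rfl := mem_antidiagonal.mp hp
  rw [nsmul_eq_mul, Nat.cast_add_choose]
  field_simp

/-- The double series behind the generating function of the Tricomi functions
converges absolutely. -/
theorem summable_tricomi_double (x σ : ℝ) :
    Summable fun p : ℕ × ℕ => σ ^ p.1 / p.1.factorial *
      ((-x) ^ p.2 / (p.2.factorial * (p.2 + p.1).factorial)) := by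
  refine Summable.of_norm_bounded
    (summable_mul_of_summable_norm (Real.summable_pow_div_factorial σ).norm
      (Real.summable_pow_div_factorial (-x)).norm).norm fun p => ?_
  rw [← div_div, ← mul_div_assoc, norm_div]
  refine div_le_self (norm_nonneg _) ?_
  rw [Real.norm_natCast]
  exact_mod_cast Nat.one_le_iff_ne_zero.mpr (Nat.factorial_ne_zero _)

theorem tricomi_generating (x σ : ℝ) :
    HasSum (fun n : ℕ => σ ^ n / n.factorial * tricomiC n x) (tricomiC 0 (x - σ)) := by
  have hF := summable_tricomi_double x σ
  have hsum : ∑' p : ℕ × ℕ, σ ^ p.1 / p.1.factorial *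
      ((-x) ^ p.2 / (p.2.factorial * (p.2 + p.1).factorial)) = tricomiC 0 (x - σ) := by
    rw [← Finset.HasAntidiagonal.sigmaAntidiagonalEquivProd.tsum_eq, tricomiC]
    refine ((Finset.HasAntidiagonal.sigmaAntidiagonalEquivProd.summable_iff.mpr hF).tsum_sigma'
      fun n => (hasSum_fintype _).summable).trans ?_
    refine tsum_congr fun n => ?_
    rw [tsum_fintype, ← div_div, add_zero, show -(x - σ) = σ + -x by ring,
      ← sum_antidiagonal_pow_div_factorial, Finset.sum_div]
    refine (Fintype.sum_congr _ _ fun p => ?_).trans (Finset.sum_coe_sort _ _)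
    have hp : (p : ℕ × ℕ).2 + (p : ℕ × ℕ).1 = n := by
      rw [add_comm]
      exact Finset.HasAntidiagonal.mem_antidiagonal.mp p.2
    simp only [Function.comp_apply, Finset.HasAntidiagonal.sigmaAntidiagonalEquivProd_apply, hp]
    rw [← div_div, mul_div_assoc]
  rw [← hsum]
  convert hF.hasSum.prod_fiberwise fun n => (hF.prod_factor n).hasSum using 2 with n
  exact tsum_mul_left.symm
end
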